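/- Let X ⊆ ℝ² be open and let f : X → ℝ be locally Lipschitz continuous. If f is directionally differentiable at some x ∈ X, then the compass difference D⋄f(x) is an element of Clarke's generalized gradient ∂f(x); that is, ⟨D⋄f(x), d⟩ ≤ f°(x;d) for every d ∈ ℝ². -/

import Mathlib

open Filter Topology Set
open scoped RealInnerProductSpace

noncomputable section

/-- `f` has one-sided directional derivative `L` at `x` in direction `d`:
`L = lim_{t→0⁺} (f(x+td) − f(x))/t`. -/
def HasDirDeriv {E : Type*} [NormedAddCommGroup E] [NormedSpace ℝ E]
    (f : E → ℝ) (x d : E) (L : ℝ) : Prop :=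
  Tendsto (fun t : ℝ => (f (x + t • d) - f x) / t) (𝓝[>] (0 : ℝ)) (𝓝 L)

/-- `f` is directionally differentiable at `x`: the one-sided directional derivative
exists (finite) in every direction. -/
def DirDiffAt {E : Type*} [NormedAddCommGroup E] [NormedSpace ℝ E]
    (f : E → ℝ) (x : E) : Prop :=
  ∀ d : E, ∃ L : ℝ, HasDirDeriv f x d L

/-- The one-sided directional derivative `f'(x;d)`. -/
def dirDeriv {E : Type*} [NormedAddCommGroup E] [NormedSpace ℝ E]
    (f : E → ℝ) (x d : E) : ℝ :=
  limUnder (𝓝[>] (0 : ℝ)) (fun t : ℝ => (f (x + t • d) - f x) / t)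

/-- The Clarke generalized directional derivative
`f°(x;d) = limsup_{y→x, t→0⁺} (f(y+td) − f(y))/t`. -/
def clarkeDD {E : Type*} [NormedAddCommGroup E] [NormedSpace ℝ E]
    (f : E → ℝ) (x d : E) : ℝ :=
  limsup (fun q : E × ℝ => (f (q.1 + q.2 • d) - f q.1) / q.2)
    ((𝓝 x) ×ˢ (𝓝[>] (0 : ℝ)))

/-- Clarke's generalized gradient `∂f(x) = {s : ⟨s,d⟩ ≤ f°(x;d) ∀ d}`. -/
def clarkeGrad {F : Type*} [NormedAddCommGroup F] [InnerProductSpace ℝ F]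
    (f : F → ℝ) (x : F) : Set F :=
  {s : F | ∀ d : F, ⟪s, d⟫ ≤ clarkeDD f x d}

/-- `f` is locally Lipschitz continuous on `X`. -/
def LocLipOn {E : Type*} [NormedAddCommGroup E] [NormedSpace ℝ E]
    (f : E → ℝ) (X : Set E) : Prop :=
  ∀ x ∈ X, ∃ K : NNReal, ∃ U ∈ 𝓝 x, LipschitzOnWith K f U

/-- The `i`-th standard unit vector of `ℝ²`. -/
def e2 (i : Fin 2) : EuclideanSpace ℝ (Fin 2) := EuclideanSpace.single i 1

/-- The compass difference
`D⋄f(x) = ½·(f'(x;e₁) − f'(x;−e₁), f'(x;e₂) − f'(x;−e₂))`. -/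
def compassDiff (f : EuclideanSpace ℝ (Fin 2) → ℝ) (x : EuclideanSpace ℝ (Fin 2)) :
    EuclideanSpace ℝ (Fin 2) :=
  ∑ i : Fin 2, ((dirDeriv f x (e2 i) - dirDeriv f x (-(e2 i))) / 2) • e2 i

lemma HasDirDeriv.smul_nonneg {E : Type*} [NormedAddCommGroup E] [NormedSpace ℝ E]
    {f : E → ℝ} {x d : E} {L a : ℝ} (h : HasDirDeriv f x d L) (ha : 0 ≤ a) :
    HasDirDeriv f x (a • d) (a * L) := by
  unfold HasDirDeriv at *
  rcases ha.eq_or_lt with rfl | ha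
  · simp
  have h1 : Tendsto (fun t : ℝ => t * a) (𝓝[>] (0 : ℝ)) (𝓝[>] (0 : ℝ)) := by
    apply tendsto_nhdsWithin_of_tendsto_nhds_of_eventually_within
    · have : Tendsto (fun t : ℝ => t * a) (𝓝 (0 : ℝ)) (𝓝 (0 * a)) :=
        tendsto_id.mul_const a
      rw [zero_mul] at this
      exact this.mono_left nhdsWithin_le_nhds
    · filter_upwards [self_mem_nhdsWithin] with t ht
      exact mul_pos ht ha
  refine ((h.comp h1).const_mul a).congr' ?_
  filter_upwards [self_mem_nhdsWithin] with t ht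
  have ht : (0 : ℝ) < t := ht
  simp only [Function.comp, smul_smul]
  field_simp

lemma HasDirDeriv.pair {E : Type*} [NormedAddCommGroup E] [NormedSpace ℝ E]
    {f : E → ℝ} {x u : E} {G H : ℝ} (hG : HasDirDeriv f x u G) (hH : HasDirDeriv f x (-u) H)
    (a : ℝ) : ∃ P N, HasDirDeriv f x (a • u) P ∧ HasDirDeriv f x (-(a • u)) N ∧
      P - N = a * (G - H) := by
  rcases le_total 0 a with ha | ha
  · refine ⟨a * G, a * H, hG.smul_nonneg ha, ?_, by ring⟩
    simpa using hH.smul_nonneg ha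
  · refine ⟨-a * H, -a * G, ?_, ?_, by ring⟩
    · simpa using hH.smul_nonneg (neg_nonneg.2 ha)
    · simpa using hG.smul_nonneg (neg_nonneg.2 ha)

lemma sub_le_clarkeDD {E : Type*} [NormedAddCommGroup E] [NormedSpace ℝ E]
    {f : E → ℝ} {x p q : E} {P N : ℝ} {K : NNReal} {U : Set E} (hU : U ∈ 𝓝 x)
    (hK : LipschitzOnWith K f U)
    (hp : HasDirDeriv f x p P) (hq : HasDirDeriv f x (-q) N) :
    P - N ≤ clarkeDD f x (p + q) := by
  have hbd : IsBoundedUnder (· ≤ ·) ((𝓝 x) ×ˢ (𝓝[>] (0 : ℝ)))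
      (fun r : E × ℝ => (f (r.1 + r.2 • (p + q)) - f r.1) / r.2) := by
    refine ⟨K * ‖p + q‖, ?_⟩
    rw [eventually_map]
    have t1 : Tendsto (fun r : E × ℝ => r.1) ((𝓝 x) ×ˢ (𝓝[>] (0 : ℝ))) (𝓝 x) := tendsto_fst
    have t2 : Tendsto (fun r : E × ℝ => r.2) ((𝓝 x) ×ˢ (𝓝[>] (0 : ℝ))) (𝓝[>] (0 : ℝ)) :=
      tendsto_snd
    have t3 : Tendsto (fun r : E × ℝ => r.1 + r.2 • (p + q))
        ((𝓝 x) ×ˢ (𝓝[>] (0 : ℝ))) (𝓝 x) := by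
      have := t1.add ((t2.mono_right nhdsWithin_le_nhds).smul_const (p + q))
      simpa using this
    filter_upwards [t1 hU, t3 hU, t2 self_mem_nhdsWithin] with r h1 h3 h2
    have h2 : 0 < r.2 := h2
    rw [div_le_iff₀ h2]
    have := hK.dist_le_mul _ h3 _ h1
    rw [Real.dist_eq, dist_eq_norm, add_sub_cancel_left, norm_smul, Real.norm_eq_abs,
      abs_of_pos h2] at this
    calc _ ≤ _ := le_abs_self _
      _ ≤ _ := this
      _ = _ := by ring
  by_contra! hlt
  obtain ⟨c, hc1, hc2⟩ := exists_between hlt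
  have hev := eventually_lt_of_limsup_lt hc1 hbd
  have t0 : Tendsto (fun t : ℝ => t) (𝓝[>] (0 : ℝ)) (𝓝 0) := nhdsWithin_le_nhds
  have t1 : Tendsto (fun t : ℝ => x + t • (-q)) (𝓝[>] (0 : ℝ)) (𝓝 x) := by
    have := (t0.smul_const (-q)).const_add x
    simpa using this
  have hev2 := (t1.prodMk (tendsto_id (x := 𝓝[>] (0 : ℝ)))).eventually hev
  have hlim := hp.sub hq
  refine absurd (le_of_tendsto hlim ?_) (not_le.2 hc2)
  filter_upwards [hev2] with t ht
  have e : x + t • (-q) + t • (p + q) = x + t • p := by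
    simp only [smul_add, smul_neg]; abel
  simp only [id, e] at ht
  rw [← sub_div]
  refine le_trans (le_of_eq ?_) ht.le
  ring

/-- for a bivariate locally Lipschitz function that is directionally
differentiable at `x`, the compass difference is a Clarke subgradient at `x`. -/
theorem compassDiff_mem_clarkeGrad
    (X : Set (EuclideanSpace ℝ (Fin 2))) (hX : IsOpen X)
    (f : EuclideanSpace ℝ (Fin 2) → ℝ) (hf : LocLipOn f X)
    (x : EuclideanSpace ℝ (Fin 2)) (hx : x ∈ X) (hdd : DirDiffAt f x) :
    compassDiff f x ∈ clarkeGrad f x := by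
  intro d
  obtain ⟨K, U, hU, hK⟩ := hf x hx
  have key : ∀ i, HasDirDeriv f x (e2 i) (dirDeriv f x (e2 i)) ∧
      HasDirDeriv f x (-(e2 i)) (dirDeriv f x (-(e2 i))) := fun i =>
    ⟨tendsto_nhds_limUnder (hdd _), tendsto_nhds_limUnder (hdd _)⟩
  obtain ⟨P, N, hP, hN, hPN⟩ := (key 0).1.pair (key 0).2 (d 0)
  obtain ⟨P', N', hP', hN', hPN'⟩ := (key 1).1.pair (key 1).2 (d 1)
  have h1 := sub_le_clarkeDD hU hK hP hN'
  have h2 := sub_le_clarkeDD hU hK hP' hN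
  have hd : d 0 • e2 0 + d 1 • e2 1 = d := by
    ext i; fin_cases i <;> simp [e2]
  rw [add_comm, hd] at h2
  rw [hd] at h1
  have hi : ⟪compassDiff f x, d⟫ = ((P - N) + (P' - N')) / 2 := by
    rw [hPN, hPN']
    simp only [compassDiff, Fin.sum_univ_two, inner_add_left, real_inner_smul_left, e2,
      EuclideanSpace.inner_single_left]
    simp
    ring
  rw [hi]
  linarith
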